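/- If a graph G with at least one edge has tree-partition-width at most k (where k ≥ 1), then G has a T-partition of width at most k for some tree T whose maximum degree is at most max{k·Δ(G), 2}. -/

import Mathlib

open SimpleGraph

/-- The maximum degree of a finite simple graph `G`:
the supremum of the numbers of neighbours of its vertices. -/
noncomputable def maxDeg {V : Type*} [Fintype V] (G : SimpleGraph V) : ℕ :=
  sSup (Set.range fun v => (G.neighborSet v).ncard)

/-- `B` is a `T`-partition of the graph `G`: the tree `T` indexes a partition
`(B x : x ∈ V(T))` of `V(G)` such that for every edge `vw` of `G`, if `v ∈ B x` and
`w ∈ B y` then `x = y` or `xy ∈ E(T)`. -/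
structure IsTreePartition {V ι : Type*} (G : SimpleGraph V) (T : SimpleGraph ι)
    (B : ι → Set V) : Prop where
  /-- `T` is a tree. -/
  isTree : T.IsTree
  /-- the parts are nonempty -/
  part_nonempty : ∀ x, (B x).Nonempty
  /-- every vertex of `G` lies in exactly one part -/
  part_existsUnique : ∀ v, ∃! x, v ∈ B x
  /-- parts containing adjacent vertices are equal or adjacent in `T` -/
  part_adj : ∀ ⦃v w x y⦄, G.Adj v w → v ∈ B x → w ∈ B y → x = y ∨ T.Adj x y

/-- `B` is a tree-decomposition of the graph `G` over the tree `T`: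
every edge of `G` has both ends in a common bag, and for each vertex `v` of `G`
the set of nodes whose bag contains `v` induces a non-empty subtree of `T`. -/
structure IsTreeDecomp {V ι : Type*} (G : SimpleGraph V) (T : SimpleGraph ι)
    (B : ι → Set V) : Prop where
  /-- `T` is a tree. -/
  isTree : T.IsTree
  /-- every edge of `G` lies in some bag -/
  edge_mem : ∀ ⦃u v⦄, G.Adj u v → ∃ x, u ∈ B x ∧ v ∈ B x
  /-- the bags containing a given vertex induce a non-empty subtree -/
  subtree : ∀ v, (T.induce {x | v ∈ B x}).Connected

/-- The treewidth of a finite graph: the minimum, over tree-decompositions,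
of the maximum bag size minus one. -/
noncomputable def treewidth {V : Type} [Fintype V] (G : SimpleGraph V) : ℕ :=
  sInf {k | ∃ (ι : Type) (_ : Fintype ι) (T : SimpleGraph ι) (B : ι → Set V),
    IsTreeDecomp G T B ∧ ∀ x, (B x).ncard ≤ k + 1}

/-- The tree-partition-width of a finite graph: the minimum width of a tree-partition. -/
noncomputable def tpw {V : Type} [Fintype V] (G : SimpleGraph V) : ℕ :=
  sInf {k | ∃ (ι : Type) (_ : Fintype ι) (T : SimpleGraph ι) (B : ι → Set V),
    IsTreePartition G T B ∧ ∀ x, (B x).ncard ≤ k}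

/-- In a finite forest every vertex is joined to a vertex of degree at most one. -/
theorem SimpleGraph.IsAcyclic.exists_reachable_ncard_neighborSet_le_one {ι : Type*} [Finite ι]
    {F : SimpleGraph ι} (hF : F.IsAcyclic) (x : ι) :
    ∃ y, F.Reachable x y ∧ (F.neighborSet y).ncard ≤ 1 := by
  obtain ⟨y, hxy, hmax⟩ := Set.exists_max_image {y | F.Reachable x y} (F.dist x)
    (Set.toFinite _) ⟨x, Reachable.refl x⟩
  refine ⟨y, hxy, ?_⟩
  obtain ⟨p, hp, hlen⟩ := hxy.exists_path_of_dist
  have hpen : ∀ z, F.Adj y z → z = p.penultimate := by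
    intro z hyz
    refine hF.eq_penultimate_of_adj_end hp hyz ?_
    by_contra hz
    have hxz : F.Reachable x z := hxy.trans hyz.reachable
    obtain ⟨q, hq, hqlen⟩ := hxz.exists_path_of_dist
    have hpq : q = p.concat hyz :=
      congrArg Subtype.val
        ((hF.subsingleton_path x z).elim ⟨q, hq⟩ ⟨p.concat hyz, hp.concat hz hyz⟩)
    have hle := hmax z hxz
    rw [← hqlen, ← hlen, hpq, Walk.length_concat] at hle
    omega
  exact (Set.ncard_le_one (Set.toFinite _)).2 fun a ha b hb => (hpen a ha).trans (hpen b hb).symm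

/-- A neighbour set grows by at most one element when an edge is added. -/
theorem SimpleGraph.ncard_neighborSet_sup_edge_le {ι : Type*} [Finite ι] (F : SimpleGraph ι)
    (a b x : ι) : ((F ⊔ edge a b).neighborSet x).ncard ≤ (F.neighborSet x).ncard + 1 := by
  classical
  refine (Set.ncard_le_ncard (t := insert (if x = a then b else a) (F.neighborSet x)) ?_
    (Set.toFinite _)).trans (Set.ncard_insert_le _ _)
  intro y hy
  simp only [mem_neighborSet, sup_adj, edge_adj, Set.mem_insert_iff] at hy ⊢
  grind

/-- A finite forest of maximum degree at most `D`, where `2 ≤ D`, extends to a tree on the same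
vertex set of maximum degree at most `D`. -/
theorem SimpleGraph.IsAcyclic.exists_isTree_ncard_neighborSet_le {ι : Type*} [Finite ι] [Nonempty ι]
    {F : SimpleGraph ι} (hF : F.IsAcyclic) {D : ℕ} (hD : 2 ≤ D)
    (hdeg : ∀ x, (F.neighborSet x).ncard ≤ D) :
    ∃ T : SimpleGraph ι, F ≤ T ∧ T.IsTree ∧ ∀ x, (T.neighborSet x).ncard ≤ D := by
  obtain ⟨T, hFT, hT⟩ := (Set.toFinite {T : SimpleGraph ι | T.IsAcyclic ∧
    ∀ x, (T.neighborSet x).ncard ≤ D}).exists_le_maximal ⟨hF, hdeg⟩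
  refine ⟨T, hFT, ⟨⟨fun u v => ?_⟩, hT.prop.1⟩, hT.prop.2⟩
  by_contra huv
  obtain ⟨a, hua, ha⟩ := hT.prop.1.exists_reachable_ncard_neighborSet_le_one u
  obtain ⟨b, hvb, hb⟩ := hT.prop.1.exists_reachable_ncard_neighborSet_le_one v
  have hab : ¬ T.Reachable a b := fun h => huv ((hua.trans h).trans hvb.symm)
  have hle : T ⊔ edge a b ≤ T := by
    refine hT.le_of_ge ⟨hT.prop.1.sup_edge_of_not_reachable hab, fun x => ?_⟩ le_sup_left
    have hx := T.ncard_neighborSet_sup_edge_le a b x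
    by_cases hxa : x = a
    · subst hxa; omega
    by_cases hxb : x = b
    · subst hxb; omega
    have heq : (T ⊔ edge a b).neighborSet x = T.neighborSet x := by
      ext y
      simp [edge_adj, hxa, hxb]
    exact heq ▸ hT.prop.2 x
  have hne : a ≠ b := fun h => hab (h ▸ Reachable.refl a)
  exact hab (hle (Or.inr ((edge_adj ..).2 ⟨Or.inl ⟨rfl, rfl⟩, hne⟩))).reachable

theorem ncard_neighborSet_le_maxDeg {V : Type*} [Fintype V] (G : SimpleGraph V) (v : V) :
    (G.neighborSet v).ncard ≤ maxDeg G :=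
  le_csSup (Set.finite_range _).bddAbove ⟨v, rfl⟩

/-- A finite nonempty graph has a tree-partition attaining the tree-partition-width. -/
theorem exists_isTreePartition_ncard_le_tpw {V : Type} [Fintype V] [Nonempty V]
    (G : SimpleGraph V) :
    ∃ (ι : Type) (_ : Fintype ι) (T : SimpleGraph ι) (B : ι → Set V),
      IsTreePartition G T B ∧ ∀ x, (B x).ncard ≤ tpw G := by
  refine Nat.sInf_mem (s := {k | ∃ (ι : Type) (_ : Fintype ι) (T : SimpleGraph ι)
    (B : ι → Set V), IsTreePartition G T B ∧ ∀ x, (B x).ncard ≤ k}) ?_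
  refine ⟨(Set.univ : Set V).ncard, Unit, inferInstance, ⊥, fun _ => Set.univ, ?_, fun _ => le_rfl⟩
  exact ⟨.of_subsingleton, fun _ => Set.univ_nonempty, fun _ => ⟨(), trivial, fun _ _ => rfl⟩,
    fun _ _ _ _ _ _ _ => Or.inl rfl⟩

/-- The nodes adjacent to `x` in `T` whose part is joined to the part of `x` by an edge of `G`
number at most the size of the part of `x` times the maximum degree of `G`. -/
theorem IsTreePartition.ncard_le_mul_maxDeg {V ι : Type*} [Fintype V] {G : SimpleGraph V}
    {T : SimpleGraph ι} {B : ι → Set V} (hB : IsTreePartition G T B) (x : ι) :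
    {y | ∃ v ∈ B x, ∃ w ∈ B y, G.Adj v w}.ncard ≤ (B x).ncard * maxDeg G := by
  classical
  choose part hpart huniq using hB.part_existsUnique
  have hsub : {y | ∃ v ∈ B x, ∃ w ∈ B y, G.Adj v w} ⊆
      part '' ⋃ v ∈ (B x).toFinset, G.neighborSet v := by
    rintro y ⟨v, hv, w, hw, hvw⟩
    refine ⟨w, ?_, (huniq w y hw).symm⟩
    simp only [Set.mem_iUnion]
    exact ⟨v, Set.mem_toFinset.2 hv, hvw⟩
  calc _ ≤ _ := Set.ncard_le_ncard hsub (Set.toFinite _)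
    _ ≤ _ := Set.ncard_image_le (Set.toFinite _)
    _ ≤ ∑ v ∈ (B x).toFinset, (G.neighborSet v).ncard := Finset.set_ncard_biUnion_le _ _
    _ ≤ (B x).toFinset.card * maxDeg G :=
      Finset.sum_le_card_nsmul _ _ _ fun v _ => ncard_neighborSet_le_maxDeg G v
    _ = (B x).ncard * maxDeg G := by rw [Set.ncard_eq_toFinset_card']

/-- If a graph `G` with at least one edge has tree-partition-width at
most `k` (where `k ≥ 1`), then `G` has a `T`-partition of width at most `k` for some tree
`T` whose maximum degree is at most `max {k·Δ(G), 2}`. -/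
theorem exists_treePartition_of_tpw_le {V : Type} [Fintype V] (G : SimpleGraph V)
    (hG : G.edgeSet.Nonempty) (k : ℕ) (hk : 1 ≤ k) (htpw : tpw G ≤ k) :
    ∃ (ι : Type) (_ : Fintype ι) (T : SimpleGraph ι) (B : ι → Set V),
      IsTreePartition G T B ∧
      (∀ x, (B x).ncard ≤ k) ∧
      (∀ x, (T.neighborSet x).ncard ≤ max (k * maxDeg G) 2) := by
  obtain ⟨e, he⟩ := hG
  induction e with | _ a b =>
  have : Nonempty V := ⟨a⟩
  obtain ⟨ι, hι, T, B, hB, hwidth⟩ := exists_isTreePartition_ncard_le_tpw G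
  have hk' : ∀ x, (B x).ncard ≤ k := fun x => (hwidth x).trans htpw
  let F : SimpleGraph ι :=
    { Adj := fun x y => T.Adj x y ∧ ∃ v ∈ B x, ∃ w ∈ B y, G.Adj v w
      symm := ⟨fun x y ⟨h, v, hv, w, hw, hvw⟩ => ⟨h.symm, w, hw, v, hv, hvw.symm⟩⟩
      loopless := ⟨fun x h => h.1.ne rfl⟩ }
  have hF : F.IsAcyclic := hB.isTree.isAcyclic.anti fun _ _ h => h.1
  have hdeg : ∀ x, (F.neighborSet x).ncard ≤ max (k * maxDeg G) 2 := fun x =>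
    calc (F.neighborSet x).ncard
        ≤ {y | ∃ v ∈ B x, ∃ w ∈ B y, G.Adj v w}.ncard :=
          Set.ncard_le_ncard (fun _ h => h.2) (Set.toFinite _)
      _ ≤ (B x).ncard * maxDeg G := hB.ncard_le_mul_maxDeg x
      _ ≤ k * maxDeg G := Nat.mul_le_mul_right _ (hk' x)
      _ ≤ _ := le_max_left _ _
  have := hB.isTree.connected.nonempty
  obtain ⟨T', hFT', hT', hdeg'⟩ :=
    hF.exists_isTree_ncard_neighborSet_le (le_max_right _ _) hdeg
  refine ⟨ι, hι, T', B, ⟨hT', hB.part_nonempty, hB.part_existsUnique, ?_⟩, hk', hdeg'⟩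
  intro v w x y hvw hv hw
  exact (hB.part_adj hvw hv hw).imp_right fun h => hFT' ⟨h, v, hv, w, hw, hvw⟩
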